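/- Let α ∈ (g,1] and z ∈ [α−1, g). The following conditions are equivalent: (i) T_α^n(z) = T_g^n(z) for all n ∈ ℕ; (ii) T_g^n(z) ≥ α − 1 for all n ∈ ℕ; (iii) T_α^n(z) < g for all n ∈ ℕ; (iv) T_α^n(z) ≤ 1/(α+1) for all n ∈ ℕ. -/

import Mathlib

open Set Filter MeasureTheory

/-- The Tanaka–Ito `α`-continued fraction map. -/
noncomputable def T (α x : ℝ) : ℝ := if x = 0 then 0 else 1 / x - (⌊1 / x + 1 - α⌋ : ℝ)

/-- The small golden mean `g = (√5 - 1)/2`. -/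
noncomputable def g : ℝ := (Real.sqrt 5 - 1) / 2

lemma g_pos : 0 < g := by
  have h : Real.sqrt 1 < Real.sqrt 5 := Real.sqrt_lt_sqrt (by norm_num) (by norm_num)
  rw [Real.sqrt_one] at h
  unfold g
  linarith

lemma g_mul_add_one : g * (g + 1) = 1 := by
  have h : Real.sqrt 5 * Real.sqrt 5 = 5 := Real.mul_self_sqrt (by norm_num)
  unfold g
  linarith

lemma T_zero (α : ℝ) : T α 0 = 0 := if_pos rfl

lemma T_eq_of_mem {α x : ℝ} (hx : x ≠ 0) (k : ℤ) (hk : 1 / x - k ∈ Set.Ico (α - 1) α) :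
    T α x = 1 / x - k := by
  have h : ⌊1 / x + 1 - α⌋ = k := by
    rw [Int.floor_eq_iff]
    constructor <;> linarith [hk.1, hk.2]
  rw [T, if_neg hx, h]

lemma T_mem {α : ℝ} (hα : α ∈ Set.Ioc 0 1) (x : ℝ) : T α x ∈ Set.Ico (α - 1) α := by
  obtain rfl | hx := eq_or_ne x 0
  · rw [T_zero]
    exact ⟨by linarith [hα.2], hα.1⟩
  · rw [T, if_neg hx]
    constructor
    · linarith [Int.floor_le (1 / x + 1 - α)]
    · linarith [Int.lt_floor_add_one (1 / x + 1 - α)]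

lemma T_eq_T_of_mem {α β x : ℝ} (h : T β x ∈ Set.Ico (α - 1) α) : T α x = T β x := by
  obtain rfl | hx := eq_or_ne x 0
  · rw [T_zero, T_zero]
  · have hβ : T β x = 1 / x - (⌊1 / x + 1 - β⌋ : ℝ) := if_neg hx
    rw [hβ] at h ⊢
    exact T_eq_of_mem hx _ h

lemma iterate_T_mem {α : ℝ} (hα : α ∈ Set.Ioc 0 1) {z : ℝ} (hz : z ∈ Set.Ico (α - 1) α)
    (n : ℕ) : (T α)^[n] z ∈ Set.Ico (α - 1) α := by
  cases n with
  | zero => exact hz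
  | succ n =>
    rw [Function.iterate_succ_apply']
    exact T_mem hα _

/-- If `x` lies in `(1 / (α + 1), g)`, then its first digit is `1` and its image exceeds `g`. -/
lemma g_lt_T {α x : ℝ} (hα : α ∈ Set.Ioc g 1) (hx : x ∈ Set.Ioo (1 / (α + 1)) g) :
    g < T α x := by
  have hg := g_pos
  have hα1 : 0 < α + 1 := by linarith [hα.1]
  have hx0 : 0 < x := (one_div_pos.2 hα1).trans hx.1
  have hlt : 1 / x < α + 1 := (one_div_lt hα1 hx0).1 hx.1
  have hgt : g + 1 < 1 / x := by
    rw [lt_div_iff₀ hx0]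
    nlinarith [g_mul_add_one, hx.2]
  have hT : T α x = 1 / x - (1 : ℤ) := by
    refine T_eq_of_mem hx0.ne' 1 ⟨?_, ?_⟩ <;> push_cast <;> linarith [hα.2]
  rw [hT]
  push_cast
  linarith

theorem stmt5 (α : ℝ) (hα : α ∈ Set.Ioc g 1) (z : ℝ) (hz : z ∈ Set.Ico (α - 1) g) :
    List.TFAE
      [∀ n : ℕ, (T α)^[n] z = (T g)^[n] z,
       ∀ n : ℕ, α - 1 ≤ (T g)^[n] z,
       ∀ n : ℕ, (T α)^[n] z < g,
       ∀ n : ℕ, (T α)^[n] z ≤ 1 / (α + 1)] := by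
  have hg := g_pos
  have hα0 : α ∈ Set.Ioc 0 1 := ⟨hg.trans hα.1, hα.2⟩
  have hg0 : g ∈ Set.Ioc 0 1 := ⟨hg, hα.1.le.trans hα.2⟩
  have hα_mem := iterate_T_mem hα0 ⟨hz.1, hz.2.trans hα.1⟩
  have hg_mem := iterate_T_mem hg0 ⟨by linarith [hz.1, hα.1], hz.2⟩
  tfae_have 1 → 2 := fun h n => h n ▸ (hα_mem n).1
  tfae_have 2 → 1 := by
    intro h n
    induction n with
    | zero => rfl
    | succ n ih =>
      have h₁ := h (n + 1)
      have h₂ := (hg_mem (n + 1)).2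
      rw [Function.iterate_succ_apply'] at h₁ h₂
      rw [Function.iterate_succ_apply', Function.iterate_succ_apply', ih]
      exact T_eq_T_of_mem ⟨h₁, h₂.trans hα.1⟩
  tfae_have 1 → 3 := fun h n => h n ▸ (hg_mem n).2
  tfae_have 3 → 1 := by
    intro h n
    induction n with
    | zero => rfl
    | succ n ih =>
      have h₁ := h (n + 1)
      have h₂ := (hα_mem (n + 1)).1
      rw [Function.iterate_succ_apply'] at h₁ h₂
      rw [Function.iterate_succ_apply', Function.iterate_succ_apply', ← ih]
      exact (T_eq_T_of_mem ⟨by linarith [hα.1], h₁⟩).symm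
  tfae_have 3 → 4 := by
    intro h n
    by_contra! hn
    have h₁ := h (n + 1)
    rw [Function.iterate_succ_apply'] at h₁
    exact h₁.not_gt (g_lt_T hα ⟨hn, h n⟩)
  tfae_have 4 → 3 := by
    intro h n
    refine (h n).trans_lt ?_
    rw [div_lt_iff₀ (by linarith [hα.1])]
    nlinarith [g_mul_add_one, hα.1]
  tfae_finish
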